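/- Let C₁ be a cycle of even length and C₂ a cycle of odd length in a graph, and suppose some edge e belongs to both. Then the symmetric difference of their edge sets, (E(C₂) \ E(C₁)) ∪ (E(C₁) \ E(C₂)), contains the edge set of an odd cycle not containing e. -/

import Mathlib

namespace SimpleGraph

variable {V : Type*} {G : SimpleGraph V}

/-- In a graph without odd cycles, bypassing preserves the parity of the length of a walk. -/
theorem Walk.even_length_bypass_iff [DecidableEq V]
    (h : ∀ (w : V) (c : G.Walk w w), c.IsCycle → Even c.length) {u v : V} (p : G.Walk u v) :
    Even p.bypass.length ↔ Even p.length := by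
  induction p with
  | nil => simp [bypass]
  | @cons u v w ha p ih =>
    simp only [bypass]
    split_ifs with hs
    · have hsplit := congrArg Walk.length (p.bypass.take_spec hs)
      rw [length_append] at hsplit
      have ht : Odd (p.bypass.takeUntil u hs).length := by
        have hp := p.bypass_isPath.takeUntil hs
        by_cases he : s(u, v) ∈ (p.bypass.takeUntil u hs).edges
        · rw [hp.length_eq_one_of_mem_edges (Sym2.eq_swap ▸ he)]
          exact odd_one
        · have := h u _ ((cons_isCycle_iff _ ha).2 ⟨hp, he⟩)
          rwa [length_cons, Nat.even_add_one, Nat.not_even_iff_odd] at this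
      rw [length_cons, Nat.even_add_one, ← ih, ← hsplit, Nat.even_add]
      rw [← Nat.not_even_iff_odd] at ht
      tauto
    · simp only [length_cons, Nat.even_add_one, ih]

/-- A graph without odd cycles is bipartite. -/
theorem isBipartite_of_forall_isCycle_even
    (h : ∀ (w : V) (c : G.Walk w w), c.IsCycle → Even c.length) : G.IsBipartite := by
  classical
  refine two_colorable_iff_forall_loop_even.2 fun u p ↦ ?_
  rw [← p.even_length_bypass_iff h, Walk.isPath_iff_nil.1 p.bypass_isPath |>.length_eq_zero]
  exact Even.zero

/-- A walk crosses a cut an even number of times iff its endpoints lie on the same side. -/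
theorem Walk.even_countP_edges_not_isDiag_map_iff (f : V → Bool) {u v : V} (p : G.Walk u v) :
    Even (p.edges.countP fun e ↦ ¬ (e.map f).IsDiag) ↔ f u = f v := by
  induction p with
  | nil => simp
  | @cons u v w ha p ih =>
    rw [edges_cons, List.countP_cons]
    cases hu : f u <;> cases hv : f v <;> cases hw : f w <;>
      simp_all [Nat.even_add_one, -Nat.not_even_iff_odd]

/-- The parity of the length of a circuit is that of the number of its edges inside the sides of
a cut. -/
theorem Walk.IsTrail.even_card_filter_isDiag_map_iff [DecidableEq V] (f : V → Bool) {u : V}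
    {p : G.Walk u u} (hp : p.IsTrail) :
    Even (p.edges.toFinset.filter fun e ↦ (e.map f).IsDiag).card ↔ Even p.length := by
  have hcard : (p.edges.toFinset.filter fun e ↦ (e.map f).IsDiag).card =
      p.edges.countP fun e ↦ (e.map f).IsDiag := by
    rw [List.countP_eq_length_filter, ← List.toFinset_card_of_nodup (hp.edges_nodup.filter _)]
    congr 1
    ext
    simp
  have hsum := p.edges.length_eq_countP_add_countP fun e ↦ decide (e.map f).IsDiag
  have hcut := (p.even_countP_edges_not_isDiag_map_iff f).2 rfl
  simp only [decide_eq_true_eq] at hsum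
  rw [hcard, ← p.length_edges, hsum, Nat.even_add]
  tauto

end SimpleGraph

/-- If an even cycle C₁ and an odd cycle C₂ share an edge e, then the symmetric
difference of their edge sets contains the edge set of an odd cycle avoiding e. -/
theorem stmt14 {V : Type*} [DecidableEq V] (G : SimpleGraph V) (a b : V)
    (C₁ : G.Walk a a) (C₂ : G.Walk b b)
    (h₁ : C₁.IsCycle) (h₂ : C₂.IsCycle)
    (heven : Even C₁.length) (hodd : Odd C₂.length)
    (e : Sym2 V) (he₁ : e ∈ C₁.edges) (he₂ : e ∈ C₂.edges) :
    ∃ (w : V) (c : G.Walk w w), c.IsCycle ∧ Odd c.length ∧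
      c.edges.toFinset ⊆
        (C₂.edges.toFinset \ C₁.edges.toFinset) ∪
          (C₁.edges.toFinset \ C₂.edges.toFinset) ∧
      e ∉ c.edges := by
  set D := (C₂.edges.toFinset \ C₁.edges.toFinset) ∪ (C₁.edges.toFinset \ C₂.edges.toFinset)
    with hD
  have hDG : ∀ x ∈ D, x ∈ G.edgeSet := by
    intro x hx
    simp only [hD, Finset.mem_union, Finset.mem_sdiff, List.mem_toFinset] at hx
    exact hx.elim (fun h ↦ C₂.edges_subset_edgeSet h.1) fun h ↦ C₁.edges_subset_edgeSet h.1
  have heD : e ∉ D := by simp [hD, he₁, he₂]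
  obtain ⟨w, c, hc, hco⟩ : ∃ (w : V) (c : (SimpleGraph.fromEdgeSet (D : Set (Sym2 V))).Walk w w),
      c.IsCycle ∧ Odd c.length := by
    by_contra! hno
    have hbip := SimpleGraph.isBipartite_of_forall_isCycle_even fun w c hc ↦
      Nat.not_odd_iff_even.1 (hno w c hc)
    let f : (SimpleGraph.fromEdgeSet (D : Set (Sym2 V))).Coloring Bool :=
      SimpleGraph.Colorable.toColoring hbip (by simp)
    have hcross : ∀ x ∈ D, ¬ (x.map f).IsDiag := by
      intro x hx
      have hxG := hDG x hx
      induction x with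
      | _ u v =>
        exact f.valid ((SimpleGraph.fromEdgeSet_adj _).2 ⟨hx, G.ne_of_adj hxG⟩)
    have heq : (C₁.edges.toFinset.filter fun x ↦ (x.map f).IsDiag) =
        C₂.edges.toFinset.filter fun x ↦ (x.map f).IsDiag := by
      ext x
      have := hcross x
      simp only [hD, Finset.mem_union, Finset.mem_sdiff] at this
      simp only [Finset.mem_filter]
      tauto
    have h₁' := h₁.isTrail.even_card_filter_isDiag_map_iff f
    rw [heq, h₂.isTrail.even_card_filter_isDiag_map_iff f] at h₁'
    exact Nat.not_even_iff_odd.2 hodd (h₁'.2 heven)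
  have hcD : ∀ x ∈ c.edges, x ∈ D := fun x hx ↦ by
    have := c.edges_subset_edgeSet hx
    rw [SimpleGraph.edgeSet_fromEdgeSet] at this
    exact this.1
  have hcG : ∀ x ∈ c.edges, x ∈ G.edgeSet := fun x hx ↦ hDG x (hcD x hx)
  refine ⟨w, c.transfer G hcG, hc.transfer hcG, by simpa using hco, fun x hx ↦ ?_, fun he ↦ ?_⟩
  · exact hcD x (by simpa using hx)
  · exact heD (hcD e (by simpa using he))
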